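/- High-probability half-space condition for Gaussian match-and-copy data: there exist universal constants c₁, c₂ > 0 such that, for tokens e⁽ⁱ⁾_t (1 ≤ i ≤ n, 1 ≤ t ≤ T) i.i.d. N(0, σ² I_d) with any σ > 0 and fixed match indices y_i ∈ {1,…,T−1}, the probability that there exist a sample i and distinct positions s, t ∈ {1,…,T−1} \ {y_i} with ⟨d_{i,s}, d_{i,t}⟩ ≤ 0 is at most c₁ n T² e^{−c₂ d}, where d_{i,t} := e⁽ⁱ⁾_{t+1} − e⁽ⁱ⁾_{y_i+1}. -/

import Mathlib

open scoped BigOperators NNReal Classical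
open Finset MeasureTheory ProbabilityTheory

noncomputable section

/-- Token at (1-based) position `t ∈ {1,…,T}` of sample `i`, read off from the sample
point `ω` of the product Gaussian space (junk value `0` outside `{1,…,T}`). -/
def tok (d T n : ℕ) (ω : Fin n × Fin T → Fin d → ℝ) (i : Fin n) (t : ℕ) : Fin d → ℝ :=
  if h : 1 ≤ t ∧ t ≤ T then ω (i, ⟨t - 1, by omega⟩) else 0

/-- The i.i.d. `N(0, σ² I_d)` product measure over all tokens of all samples. -/
def gmcMeasure (d T n : ℕ) (σ : ℝ≥0) : Measure (Fin n × Fin T → Fin d → ℝ) :=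
  Measure.pi fun _ : Fin n × Fin T =>
    Measure.pi fun _ : Fin d => gaussianReal 0 (σ ^ 2)

/-- Error directions `d_{i,t} := e⁽ⁱ⁾_{t+1} − e⁽ⁱ⁾_{y_i+1}`. -/
def dvec (d T n : ℕ) (ω : Fin n × Fin T → Fin d → ℝ) (y : Fin n → ℕ)
    (i : Fin n) (t : ℕ) : Fin d → ℝ :=
  fun k => tok d T n ω i (t + 1) k - tok d T n ω i (y i + 1) k

open scoped ENNReal

/-- Gaussian integral of the exponential of a quadratic, by completing the square. -/
lemma lintegral_exp_gaussianReal_of_complete_square {v w : ℝ≥0} (hv : v ≠ 0) (hw : w ≠ 0)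
    (f : ℝ → ℝ) (m κ : ℝ)
    (hf : ∀ x, f x - x ^ 2 / (2 * v) = κ - (x - m) ^ 2 / (2 * w)) :
    ∫⁻ x, ENNReal.ofReal (Real.exp (f x)) ∂(gaussianReal 0 v)
      = ENNReal.ofReal (√(w / v) * Real.exp κ) := by
  have hv' : (0 : ℝ) < v := by positivity
  have hw' : (0 : ℝ) < w := by positivity
  have hf' : f = fun x => κ - (x - m) ^ 2 / (2 * w) + x ^ 2 / (2 * v) :=
    funext fun x => by linarith [hf x]
  have hfm : Measurable f := by rw [hf']; fun_prop
  rw [gaussianReal_of_var_ne_zero _ hv,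
    lintegral_withDensity_eq_lintegral_mul _ (measurable_gaussianPDF _ _) (by fun_prop)]
  have key : ∀ x, (gaussianPDF 0 v * fun x => ENNReal.ofReal (Real.exp (f x))) x
      = ENNReal.ofReal (√(w / v) * Real.exp κ) * gaussianPDF m w x := by
    intro x
    simp only [Pi.mul_apply, gaussianPDF]
    rw [← ENNReal.ofReal_mul (gaussianPDFReal_nonneg _ _ _), ← ENNReal.ofReal_mul (by positivity)]
    congr 1
    simp only [gaussianPDFReal, sub_zero]
    have hsqrt : (√(2 * Real.pi * v))⁻¹ = √(w / v) * (√(2 * Real.pi * w))⁻¹ := by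
      rw [← Real.sqrt_inv, ← Real.sqrt_inv, ← Real.sqrt_mul (by positivity)]
      congr 1
      field_simp
    have hexp : Real.exp (-x ^ 2 / (2 * v)) * Real.exp (f x)
        = Real.exp κ * Real.exp (-(x - m) ^ 2 / (2 * w)) := by
      rw [← Real.exp_add, ← Real.exp_add]
      congr 1
      rw [neg_div, neg_div]
      linarith [hf x]
    rw [mul_assoc, hexp, hsqrt]
    ring
  rw [lintegral_congr key, lintegral_const_mul _ (measurable_gaussianPDF _ _),
    lintegral_gaussianPDF_eq_one _ hw, mul_one]

/-- Exponential moment of `(A - C) (B - C)` at `-1 / (3 v)` for i.i.d. `A, B, C ∼ N(0, v)`. -/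
lemma lintegral_exp_neg_mul_sub_gaussianReal {v : ℝ≥0} (hv : v ≠ 0) :
    ∫⁻ c, ∫⁻ b, ∫⁻ a, ENNReal.ofReal (Real.exp (-((a - c) * (b - c)) / (3 * v)))
        ∂(gaussianReal 0 v) ∂(gaussianReal 0 v) ∂(gaussianReal 0 v)
      = ENNReal.ofReal √(3 / 4) := by
  have hv' : (v : ℝ) ≠ 0 := by exact_mod_cast hv
  have ha : ∀ c b : ℝ, ∫⁻ a, ENNReal.ofReal (Real.exp (-((a - c) * (b - c)) / (3 * v)))
        ∂(gaussianReal 0 v)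
      = ENNReal.ofReal (Real.exp (c * (b - c) / (3 * v) + (b - c) ^ 2 / (18 * v))) := by
    intro c b
    rw [lintegral_exp_gaussianReal_of_complete_square hv hv _ (-(b - c) / 3)
      (c * (b - c) / (3 * v) + (b - c) ^ 2 / (18 * v)), div_self hv', Real.sqrt_one, one_mul]
    intro x
    field_simp
    ring
  have hb : ∀ c : ℝ, ∫⁻ b, ENNReal.ofReal
        (Real.exp (c * (b - c) / (3 * v) + (b - c) ^ 2 / (18 * v))) ∂(gaussianReal 0 v)
      = ENNReal.ofReal √(9 / 8) * ENNReal.ofReal (Real.exp (-c ^ 2 / (4 * v))) := by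
    intro c
    rw [lintegral_exp_gaussianReal_of_complete_square hv
      (w := 9 / 8 * v) (by positivity) _ (c / 4) (-c ^ 2 / (4 * v)),
      ENNReal.ofReal_mul (by positivity)]
    · congr 3
      push_cast
      field_simp
    · intro x
      push_cast
      field_simp
      ring
  have hc : ∫⁻ c, ENNReal.ofReal (Real.exp (-c ^ 2 / (4 * v))) ∂(gaussianReal 0 v)
      = ENNReal.ofReal √(2 / 3) := by
    rw [lintegral_exp_gaussianReal_of_complete_square hv
      (w := 2 / 3 * v) (by positivity) _ 0 0, Real.exp_zero, mul_one]
    · congr 2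
      push_cast
      field_simp
    · intro x
      push_cast
      field_simp
      ring
  simp_rw [ha, hb]
  rw [lintegral_const_mul _ (by fun_prop), hc, ← ENNReal.ofReal_mul (by positivity),
    ← Real.sqrt_mul (by positivity)]
  norm_num

/-- Distinct coordinates of a power of a probability measure have a product joint law. -/
lemma lintegral_pi_three_coords {ι E : Type*} [Fintype ι] [MeasurableSpace E] (ν : Measure E)
    [IsProbabilityMeasure ν] {p q r : ι} (hpq : p ≠ q) (hpr : p ≠ r) (hqr : q ≠ r)
    {G : E → E → E → ℝ≥0∞} (hG : Measurable fun z : (E × E) × E => G z.1.1 z.1.2 z.2) :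
    ∫⁻ ω, G (ω r) (ω q) (ω p) ∂(Measure.pi fun _ : ι => ν)
      = ∫⁻ c, ∫⁻ b, ∫⁻ a, G c b a ∂ν ∂ν ∂ν := by
  set μ := Measure.pi fun _ : ι => ν
  have hind : iIndepFun (fun (i : ι) (ω : ι → E) => ω i) μ :=
    iIndepFun_pi (X := fun _ => id) fun _ => aemeasurable_id
  have hmap : ∀ i, μ.map (fun ω => ω i) = ν := fun i =>
    (measurePreserving_eval (fun _ : ι => ν) i).map_eq
  have hrq : μ.map (fun ω => (ω r, ω q)) = ν.prod ν := by
    rw [(indepFun_iff_map_prod_eq_prod_map_map (measurable_pi_apply r).aemeasurable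
      (measurable_pi_apply q).aemeasurable).1 (hind.indepFun hqr.symm), hmap, hmap]
  have hrqp : μ.map (fun ω => ((ω r, ω q), ω p)) = (ν.prod ν).prod ν := by
    rw [(indepFun_iff_map_prod_eq_prod_map_map
      ((measurable_pi_apply r).prodMk (measurable_pi_apply q)).aemeasurable
      (measurable_pi_apply p).aemeasurable).1
      (hind.indepFun_prodMk (fun i => measurable_pi_apply i) r q p hpr.symm hpq.symm), hrq, hmap]
  have hmeas : Measurable fun ω : ι → E => ((ω r, ω q), ω p) := by fun_prop
  rw [← lintegral_map (μ := μ) (f := fun z : (E × E) × E => G z.1.1 z.1.2 z.2) hG hmeas, hrqp,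
    lintegral_prod _ hG.aemeasurable, lintegral_prod _ hG.lintegral_prod_right'.aemeasurable]

/-- The integral of a product of functions of separate coordinates is the product of integrals. -/
lemma lintegral_pi_prod_eq_prod {κ E : Type*} [Fintype κ] [MeasurableSpace E] (γ : Measure E)
    [IsProbabilityMeasure γ] {f : κ → E → ℝ≥0∞} (hf : ∀ k, Measurable (f k)) :
    ∫⁻ x, ∏ k, f k (x k) ∂(Measure.pi fun _ : κ => γ) = ∏ k, ∫⁻ a, f k a ∂γ := by
  rw [lintegral_prod_eq_prod_lintegral_of_indepFun Finset.univ
    (fun k (x : κ → E) => f k (x k)) (iIndepFun_pi fun k => (hf k).aemeasurable)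
    fun k => (hf k).comp (measurable_pi_apply k)]
  exact Finset.prod_congr rfl fun k _ =>
    (measurePreserving_eval (fun _ : κ => γ) k).lintegral_comp (hf k)

/-- A triple integral of a product over coordinates against powers of `γ` factorizes. -/
lemma lintegral_pi_prod_three {κ E : Type*} [Fintype κ] [MeasurableSpace E] (γ : Measure E)
    [IsProbabilityMeasure γ] {F : E → E → E → ℝ≥0∞}
    (hF : Measurable fun z : (E × E) × E => F z.1.1 z.1.2 z.2) :
    ∫⁻ c, ∫⁻ b, ∫⁻ a, ∏ k, F (c k) (b k) (a k) ∂(Measure.pi fun _ : κ => γ)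
        ∂(Measure.pi fun _ : κ => γ) ∂(Measure.pi fun _ : κ => γ)
      = (∫⁻ c, ∫⁻ b, ∫⁻ a, F c b a ∂γ ∂γ ∂γ) ^ Fintype.card κ := by
  have hFa : ∀ c b, Measurable (F c b) := fun c b => hF.comp (measurable_prodMk_left (x := (c, b)))
  have hFba : Measurable fun z : E × E => ∫⁻ a, F z.1 z.2 a ∂γ :=
    hF.lintegral_prod_right' (ν := γ)
  have hFb : ∀ c, Measurable fun b => ∫⁻ a, F c b a ∂γ := fun c =>
    hFba.comp (measurable_prodMk_left (x := c))
  have hFc : Measurable fun c => ∫⁻ b, ∫⁻ a, F c b a ∂γ ∂γ :=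
    hFba.lintegral_prod_right' (ν := γ)
  have ha : ∀ c b : κ → E, ∫⁻ a, ∏ k, F (c k) (b k) (a k) ∂(Measure.pi fun _ : κ => γ)
      = ∏ k, ∫⁻ a, F (c k) (b k) a ∂γ :=
    fun c b => lintegral_pi_prod_eq_prod γ
      (f := fun k a => F (c k) (b k) a) fun k => hFa _ _
  have hb : ∀ c : κ → E, ∫⁻ b, ∏ k, ∫⁻ a, F (c k) (b k) a ∂γ ∂(Measure.pi fun _ : κ => γ)
      = ∏ k, ∫⁻ b, ∫⁻ a, F (c k) b a ∂γ ∂γ :=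
    fun c => lintegral_pi_prod_eq_prod γ
      (f := fun k b => ∫⁻ a, F (c k) b a ∂γ) fun k => hFb _
  simp_rw [ha, hb]
  rw [lintegral_pi_prod_eq_prod γ
    (f := fun (_ : κ) c => ∫⁻ b, ∫⁻ a, F c b a ∂γ ∂γ) fun _ => hFc,
    Finset.prod_const, Finset.card_univ]

/-- Chernoff bound for one pair of error directions. -/
lemma pi_gaussianReal_sum_mul_sub_nonpos_le {ι : Type*} [Fintype ι] (d : ℕ) {v : ℝ≥0} (hv : v ≠ 0)
    {p q r : ι} (hpq : p ≠ q) (hpr : p ≠ r) (hqr : q ≠ r) :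
    (Measure.pi fun _ : ι => Measure.pi fun _ : Fin d => gaussianReal 0 v)
        {ω | ∑ k, (ω p k - ω r k) * (ω q k - ω r k) ≤ 0}
      ≤ ENNReal.ofReal √(3 / 4) ^ d := by
  obtain ⟨F, hFdef⟩ : ∃ F : ℝ → ℝ → ℝ → ℝ≥0∞, F = fun c b a =>
    ENNReal.ofReal (Real.exp (-((a - c) * (b - c)) / (3 * v))) := ⟨_, rfl⟩
  have hF : Measurable fun z : (ℝ × ℝ) × ℝ => F z.1.1 z.1.2 z.2 := by
    rw [hFdef]
    fun_prop
  have hG : Measurable fun z : ((Fin d → ℝ) × (Fin d → ℝ)) × (Fin d → ℝ) =>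
      ∏ k, F (z.1.1 k) (z.1.2 k) (z.2 k) :=
    Finset.measurable_prod _ fun k _ => hF.comp
      (f := fun z : ((Fin d → ℝ) × (Fin d → ℝ)) × (Fin d → ℝ) => ((z.1.1 k, z.1.2 k), z.2 k))
      (by fun_prop)
  have hGω : Measurable fun ω : ι → Fin d → ℝ => ∏ k, F (ω r k) (ω q k) (ω p k) :=
    hG.comp (f := fun ω : ι → Fin d → ℝ => ((ω r, ω q), ω p))
      (((measurable_pi_apply r).prodMk (measurable_pi_apply q)).prodMk (measurable_pi_apply p))
  have hone : ∀ ω ∈ {ω : ι → Fin d → ℝ | ∑ k, (ω p k - ω r k) * (ω q k - ω r k) ≤ 0},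
      1 ≤ ∏ k, F (ω r k) (ω q k) (ω p k) := by
    intro ω hω
    rw [hFdef, ← ENNReal.ofReal_prod_of_nonneg fun _ _ => (Real.exp_pos _).le, ← Real.exp_sum,
      ENNReal.one_le_ofReal, Real.one_le_exp_iff, ← Finset.sum_div, Finset.sum_neg_distrib]
    exact div_nonneg (neg_nonneg.2 hω) (by positivity)
  refine (measure_mono hone).trans ?_
  have hmarkov := mul_meas_ge_le_lintegral₀ hGω.aemeasurable 1
    (μ := Measure.pi fun _ : ι => Measure.pi fun _ : Fin d => gaussianReal 0 v)
  rw [one_mul] at hmarkov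
  refine hmarkov.trans (le_of_eq ?_)
  rw [lintegral_pi_three_coords (Measure.pi fun _ : Fin d => gaussianReal 0 v) hpq hpr hqr
    (G := fun c b a => ∏ k, F (c k) (b k) (a k)) hG, lintegral_pi_prod_three _ hF, hFdef,
    lintegral_exp_neg_mul_sub_gaussianReal hv, Fintype.card_fin]

/-- High-probability half-space condition for Gaussian match-and-copy
data: there are universal constants `c₁, c₂ > 0` such that, for i.i.d. `N(0, σ² I_d)`
tokens, the probability that some sample has two distinct distractor positions with
`⟨d_{i,s}, d_{i,t}⟩ ≤ 0` is at most `c₁ n T² e^{−c₂ d}`. -/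
theorem stmt_9 :
    ∃ c₁ > (0 : ℝ), ∃ c₂ > (0 : ℝ), ∀ (d T n : ℕ), 1 ≤ d → 3 ≤ T → 1 ≤ n →
      ∀ (σ : ℝ≥0), 0 < σ → ∀ (y : Fin n → ℕ), (∀ i, y i ∈ Finset.Icc 1 (T - 1)) →
      (gmcMeasure d T n σ
        {ω | ∃ i : Fin n, ∃ s ∈ (Finset.Icc 1 (T - 1)).erase (y i),
          ∃ t ∈ ((Finset.Icc 1 (T - 1)).erase (y i)).erase s,
            (∑ k : Fin d, dvec d T n ω y i s k * dvec d T n ω y i t k) ≤ 0}).toReal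
        ≤ c₁ * n * T ^ 2 * Real.exp (-(c₂ * d)) := by
  have hlog : Real.log √(3 / 4) < 0 :=
    Real.log_neg (by positivity) (by rw [Real.sqrt_lt' one_pos]; norm_num)
  refine ⟨1, one_pos, -Real.log √(3 / 4), neg_pos.2 hlog, ?_⟩
  intro d T n _ _ _ σ hσ y hy
  have hexp : Real.exp (-(-Real.log √(3 / 4) * d)) = √(3 / 4) ^ d := by
    rw [neg_mul, neg_neg, mul_comm, Real.exp_nat_mul, Real.exp_log (by positivity)]
  rw [hexp, one_mul]
  have hpair : ∀ i, ∀ s ∈ (Finset.Icc 1 (T - 1)).erase (y i),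
      ∀ t ∈ ((Finset.Icc 1 (T - 1)).erase (y i)).erase s,
      gmcMeasure d T n σ {ω | (∑ k : Fin d, dvec d T n ω y i s k * dvec d T n ω y i t k) ≤ 0}
        ≤ ENNReal.ofReal √(3 / 4) ^ d := by
    intro i s hs t ht
    have hyi := hy i
    simp only [Finset.mem_erase, Finset.mem_Icc] at hs ht hyi
    have hs' : 1 ≤ s + 1 ∧ s + 1 ≤ T := by omega
    have ht' : 1 ≤ t + 1 ∧ t + 1 ≤ T := by omega
    have hy' : 1 ≤ y i + 1 ∧ y i + 1 ≤ T := by omega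
    simp only [dvec, tok, dif_pos hs', dif_pos ht', dif_pos hy']
    refine pi_gaussianReal_sum_mul_sub_nonpos_le d (pow_ne_zero 2 hσ.ne') ?_ ?_ ?_ <;>
      simp only [ne_eq, Prod.mk.injEq, Fin.mk.injEq, true_and] <;> omega
  have hunion : gmcMeasure d T n σ
      {ω | ∃ i : Fin n, ∃ s ∈ (Finset.Icc 1 (T - 1)).erase (y i),
          ∃ t ∈ ((Finset.Icc 1 (T - 1)).erase (y i)).erase s,
            (∑ k : Fin d, dvec d T n ω y i s k * dvec d T n ω y i t k) ≤ 0}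
      ≤ ENNReal.ofReal (n * T ^ 2 * √(3 / 4) ^ d) := by
    have hcard : ∀ {A : Finset ℕ} {x : ℝ≥0∞}, A ⊆ Finset.Icc 1 (T - 1) →
        ∑ _a ∈ A, x ≤ T * x := by
      intro A x hA
      rw [Finset.sum_const, nsmul_eq_mul]
      gcongr
      refine (Finset.card_le_card hA).trans ?_
      rw [Nat.card_Icc]
      omega
    simp only [Set.ofPred_exists, ← exists_prop]
    calc _ ≤ ∑ _i : Fin n, (T * (T * ENNReal.ofReal √(3 / 4) ^ d) : ℝ≥0∞) := by
          refine (measure_iUnion_fintype_le _ _).trans (Finset.sum_le_sum fun i _ => ?_)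
          refine (measure_biUnion_finset_le _ _).trans <|
            (Finset.sum_le_sum fun s hs => ?_).trans (hcard (Finset.erase_subset _ _))
          exact (measure_biUnion_finset_le _ _).trans <|
            (Finset.sum_le_sum fun t ht => hpair i s hs t ht).trans
              (hcard ((Finset.erase_subset _ _).trans (Finset.erase_subset _ _)))
      _ = ENNReal.ofReal (n * T ^ 2 * √(3 / 4) ^ d) := by
          rw [Finset.sum_const, Finset.card_univ, Fintype.card_fin, nsmul_eq_mul,
            ENNReal.ofReal_mul (by positivity), ENNReal.ofReal_mul (by positivity),
            ENNReal.ofReal_pow (by positivity), ENNReal.ofReal_pow (by positivity),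
            ENNReal.ofReal_natCast, ENNReal.ofReal_natCast]
          ring
  exact ENNReal.toReal_le_of_le_ofReal (by positivity) hunion
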